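/- arXiv:1907.11915 — 5 statements merged into one kernel-verified Lean document; each statement's English description precedes it below -/
import Mathlib

section
/- For every family of demand maps D_1,…,D_m as in the model, a market clearing pure Nash equilibrium exists if and only if: for every item i ∈ N and every j ∈ {1,…,m}, v_{π_i(j),i} − c_i ≤ (m/(m−j+1)) · (v_{π_i(1),i} − c_i), and for every item i ∈ N, min_{j∈M} v_{j,i} ≥ c_i. -/
open Finset

/-- Utility of a buyer with valuation `v` for bundle `S` at prices `p`. -/
def util {n : ℕ} (v : Finset (Fin n) → ℝ) (p : Fin n → ℝ) (S : Finset (Fin n)) : ℝ :=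
  v S - ∑ i ∈ S, p i

/-- `v` is a normalized, nonnegative, monotone, submodular valuation. -/
def IsValuation {n : ℕ} (v : Finset (Fin n) → ℝ) : Prop :=
  v ∅ = 0 ∧ (∀ S, 0 ≤ v S) ∧ (∀ S T, S ⊆ T → v S ≤ v T) ∧
    ∀ (S T : Finset (Fin n)) (x : Fin n), S ⊆ T → x ∉ T →
      v (insert x T) - v T ≤ v (insert x S) - v S

/-- `v` is additive. -/
def IsAdditive {n : ℕ} (v : Finset (Fin n) → ℝ) : Prop :=
  ∀ S, v S = ∑ i ∈ S, v {i}

/-- `D` is a demand map for valuation `v`: at every price vector it selects a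
utility-maximizing bundle of maximum cardinality among maximizers. -/
def IsDemandMap {n : ℕ} (v : Finset (Fin n) → ℝ)
    (D : (Fin n → ℝ) → Finset (Fin n)) : Prop :=
  ∀ p, (∀ S, util v p S ≤ util v p (D p)) ∧
    ∀ S, util v p S = util v p (D p) → S.card ≤ (D p).card

/-- Profit of seller `i`: number of buyers purchasing item `i` times `p i - c i`. -/
def profit {n m : ℕ} (D : Fin m → (Fin n → ℝ) → Finset (Fin n)) (c : Fin n → ℝ)
    (p : Fin n → ℝ) (i : Fin n) : ℝ :=
  ((Finset.univ.filter fun j : Fin m => i ∈ D j p).card : ℝ) * (p i - c i)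

/-- Pure Nash equilibrium of the sellers' pricing game (prices are nonnegative
and no seller can strictly increase profit by a unilateral price change). -/
def IsPNE {n m : ℕ} (D : Fin m → (Fin n → ℝ) → Finset (Fin n)) (c : Fin n → ℝ)
    (p : Fin n → ℝ) : Prop :=
  (∀ i, 0 ≤ p i) ∧
    ∀ (i : Fin n) (q : ℝ), 0 ≤ q →
      profit D c (Function.update p i q) i ≤ profit D c p i

/-- `ε`-Nash equilibrium: no seller gains more than `ε` by deviating. -/
def IsEpsNE {n m : ℕ} (D : Fin m → (Fin n → ℝ) → Finset (Fin n)) (c : Fin n → ℝ)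
    (ε : ℝ) (p : Fin n → ℝ) : Prop :=
  (∀ i, 0 ≤ p i) ∧
    ∀ (i : Fin n) (q : ℝ), 0 ≤ q →
      profit D c (Function.update p i q) i ≤ profit D c p i + ε

/-- Market clearing: every buyer purchases every item. -/
def MarketClearing {n m : ℕ} (D : Fin m → (Fin n → ℝ) → Finset (Fin n))
    (p : Fin n → ℝ) : Prop :=
  ∀ j : Fin m, D j p = Finset.univ

/-- `vmarg v j i = v_j(N) - v_j(N \ {i})`. -/
def vmarg {n m : ℕ} (v : Fin m → Finset (Fin n) → ℝ) (j : Fin m) (i : Fin n) : ℝ :=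
  v j Finset.univ - v j (Finset.univ.erase i)

/-- Social welfare of the allocation induced by prices `p`. -/
def SW {n m : ℕ} (v : Fin m → Finset (Fin n) → ℝ)
    (D : Fin m → (Fin n → ℝ) → Finset (Fin n)) (c : Fin n → ℝ)
    (p : Fin n → ℝ) : ℝ :=
  ∑ j : Fin m, (v j (D j p) - ∑ i ∈ D j p, c i)

/-- The marginal values with respect to the grand bundle underestimate the loss in value
caused by removing a set of items from it. -/
lemma sum_marginal_le {n : ℕ} {v : Finset (Fin n) → ℝ} (hv : IsValuation v)
    (T : Finset (Fin n)) :
    ∑ i ∈ T, (v univ - v (univ.erase i)) ≤ v univ - v Tᶜ := by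
  induction T using Finset.induction_on with
  | empty => simp
  | insert x T hx ih =>
    have h := hv.2.2.2 (insert x T)ᶜ (univ.erase x) x
      (fun y hy => by simp at hy ⊢; exact hy.1) (by simp)
    have h₁ : insert x (univ.erase x) = univ := by simp
    have h₂ : insert x (insert x T)ᶜ = Tᶜ := by
      ext y
      by_cases hy : y = x <;> simp [hy, hx]
    rw [h₁, h₂] at h
    rw [Finset.sum_insert hx]
    linarith

/-- If the items outside `S` are priced at most at their marginal values, then the grand
bundle is at least as good as `S`. -/
lemma util_le_util_univ {n : ℕ} {v : Finset (Fin n) → ℝ} (hv : IsValuation v)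
    {p : Fin n → ℝ} {S : Finset (Fin n)}
    (h : ∀ i ∉ S, p i ≤ v univ - v (univ.erase i)) : util v p S ≤ util v p univ := by
  have h₁ := sum_marginal_le hv Sᶜ
  have h₂ : ∑ i ∈ Sᶜ, p i ≤ ∑ i ∈ Sᶜ, (v univ - v (univ.erase i)) :=
    Finset.sum_le_sum fun i hi => h i (by simpa using hi)
  have h₃ := Finset.sum_add_sum_compl S p
  rw [compl_compl] at h₁
  unfold util
  linarith

lemma le_marginal_of_util_erase_le {n : ℕ} {v : Finset (Fin n) → ℝ} {p : Fin n → ℝ} {i : Fin n}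
    (h : util v p (univ.erase i) ≤ util v p univ) : p i ≤ v univ - v (univ.erase i) := by
  have h₁ := Finset.add_sum_erase univ p (Finset.mem_univ i)
  unfold util at h
  linarith

lemma IsDemandMap.eq_univ {n : ℕ} {v : Finset (Fin n) → ℝ} (hv : IsValuation v)
    {D : (Fin n → ℝ) → Finset (Fin n)} (hD : IsDemandMap v D) {p : Fin n → ℝ}
    (h : ∀ i, p i ≤ v univ - v (univ.erase i)) : D p = univ :=
  Finset.eq_univ_of_card _ <| le_antisymm (Finset.card_le_univ _) <|
    (hD p).2 univ <| le_antisymm ((hD p).1 _) (util_le_util_univ hv fun i _ => h i)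

/-- If all other items are priced at most at their marginal values, an item is demanded
exactly when its price is at most its marginal value. -/
lemma IsDemandMap.mem_update_iff {n : ℕ} {v : Finset (Fin n) → ℝ} (hv : IsValuation v)
    {D : (Fin n → ℝ) → Finset (Fin n)} (hD : IsDemandMap v D) {p : Fin n → ℝ}
    (h : ∀ i, p i ≤ v univ - v (univ.erase i)) (i : Fin n) (q : ℝ) :
    i ∈ D (Function.update p i q) ↔ q ≤ v univ - v (univ.erase i) := by
  have h_ne : ∀ k, k ≠ i → Function.update p i q k ≤ v univ - v (univ.erase k) := fun k hk => by
    rw [Function.update_of_ne hk]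
    exact h k
  constructor
  · intro hi
    have h₁ : util v (Function.update p i q) (D (Function.update p i q)) ≤
        util v (Function.update p i q) univ :=
      util_le_util_univ hv fun k hk => h_ne k fun hki => hk (hki ▸ hi)
    simpa using
      le_marginal_of_util_erase_le (i := i) (((hD (Function.update p i q)).1 _).trans h₁)
  · intro hq
    rw [hD.eq_univ hv fun k => ?_]
    · exact Finset.mem_univ i
    · by_cases hk : k = i
      · subst hk
        simpa using hq
      · exact h_ne k hk

lemma profit_update {n m : ℕ} {v : Fin m → Finset (Fin n) → ℝ} (hv : ∀ j, IsValuation (v j))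
    {D : Fin m → (Fin n → ℝ) → Finset (Fin n)} (hD : ∀ j, IsDemandMap (v j) (D j))
    (c : Fin n → ℝ) {p : Fin n → ℝ} (h : ∀ i j, p i ≤ vmarg v j i) (i : Fin n) (q : ℝ) :
    profit D c (Function.update p i q) i =
      ((univ.filter fun j : Fin m => q ≤ vmarg v j i).card : ℝ) * (q - c i) := by
  unfold profit
  rw [Function.update_self, Finset.filter_congr fun j _ =>
    (hD j).mem_update_iff (hv j) (fun k => h k j) i q]
  rfl

lemma profit_of_marketClearing {n m : ℕ} {D : Fin m → (Fin n → ℝ) → Finset (Fin n)}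
    {p : Fin n → ℝ} (h : MarketClearing D p) (c : Fin n → ℝ) (i : Fin n) :
    profit D c p i = m * (p i - c i) := by
  unfold profit
  rw [Finset.filter_true_of_mem fun j _ => by simp [h j]]
  simp

/-- a market clearing pure Nash equilibrium exists iff for every
item `i` and every (1-based) index `j+1`,
`v_{π_i(j+1),i} - c_i ≤ (m/(m-j)) (v_{π_i(1),i} - c_i)`, and for every item
`i`, `min_j v_{j,i} ≥ c_i`. -/
theorem marketClearing_iff_sorted_condition {n m : ℕ} (hm : 0 < m)
    (v : Fin m → Finset (Fin n) → ℝ) (c : Fin n → ℝ)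
    (hv : ∀ j, IsValuation (v j)) (hc : ∀ i, 0 ≤ c i)
    (π : Fin n → Equiv.Perm (Fin m))
    (hπ : ∀ (i : Fin n) (j k : Fin m), j ≤ k → vmarg v (π i j) i ≤ vmarg v (π i k) i)
    (D : Fin m → (Fin n → ℝ) → Finset (Fin n))
    (hD : ∀ j, IsDemandMap (v j) (D j)) :
    (∃ p, IsPNE D c p ∧ MarketClearing D p) ↔
      ((∀ (i : Fin n) (j : Fin m),
          vmarg v (π i j) i - c i ≤
            (m : ℝ) / ((m : ℝ) - (j.val : ℝ)) * (vmarg v (π i ⟨0, hm⟩) i - c i)) ∧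
        ∀ (i : Fin n) (j : Fin m), c i ≤ vmarg v j i) := by
  have h_first : ∀ i j, vmarg v (π i ⟨0, hm⟩) i ≤ vmarg v j i := fun i j => by
    have h := hπ i ⟨0, hm⟩ ((π i).symm j) (Nat.zero_le _)
    rwa [Equiv.apply_symm_apply] at h
  have h_nonneg : ∀ i j, 0 ≤ vmarg v j i := fun i j =>
    sub_nonneg.2 ((hv j).2.2.1 _ _ (Finset.subset_univ _))
  have hm' : (0 : ℝ) < m := Nat.cast_pos.2 hm
  have h_sub : ∀ j : Fin m, (0 : ℝ) < m - (j.val : ℝ) := fun j =>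
    sub_pos.2 (Nat.cast_lt.2 j.isLt)
  have h_card : ∀ i (j : Fin m),
      ((((Finset.Ici j).map (π i).toEmbedding).card : ℕ) : ℝ) = m - (j.val : ℝ) := fun i j => by
    rw [Finset.card_map, Fin.card_Ici, Nat.cast_sub j.isLt.le]
  constructor
  · rintro ⟨p, ⟨-, hNE⟩, hMC⟩
    have hp : ∀ i j, p i ≤ vmarg v j i := fun i j => by
      refine le_marginal_of_util_erase_le ?_
      have h := (hD j p).1 (univ.erase i)
      rwa [hMC j] at h
    have h_dev : ∀ i q, 0 ≤ q →
        ((univ.filter fun j : Fin m => q ≤ vmarg v j i).card : ℝ) * (q - c i) ≤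
          m * (vmarg v (π i ⟨0, hm⟩) i - c i) := fun i q hq => by
      have h := hNE i q hq
      rw [profit_update hv hD c hp, profit_of_marketClearing hMC] at h
      exact h.trans (mul_le_mul_of_nonneg_left (sub_le_sub_right (hp i _) _) hm'.le)
    have h_cost : ∀ i j, c i ≤ vmarg v j i := fun i j => by
      have h := h_dev i (c i) (hc i)
      rw [sub_self, mul_zero] at h
      exact (sub_nonneg.1 (nonneg_of_mul_nonneg_right h hm')).trans (h_first i j)
    refine ⟨fun i j => ?_, h_cost⟩
    rw [div_mul_eq_mul_div, le_div_iff₀ (h_sub j), mul_comm]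
    refine le_trans ?_ (h_dev i (vmarg v (π i j) i) (h_nonneg i _))
    refine mul_le_mul_of_nonneg_right ?_ (sub_nonneg.2 (h_cost i _))
    rw [← h_card i j, Nat.cast_le]
    refine Finset.card_le_card fun k hk => ?_
    obtain ⟨l, hl, rfl⟩ := Finset.mem_map.1 hk
    exact Finset.mem_filter.2 ⟨Finset.mem_univ _, hπ i j l (Finset.mem_Ici.1 hl)⟩
  · rintro ⟨h_sorted, h_cost⟩
    have hMC : MarketClearing D fun i => vmarg v (π i ⟨0, hm⟩) i := fun j =>
      (hD j).eq_univ (hv j) fun i => h_first i j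
    refine ⟨_, ⟨fun i => h_nonneg i _, fun i q _ => ?_⟩, hMC⟩
    rw [profit_update hv hD c h_first, profit_of_marketClearing hMC]
    have h_rhs : 0 ≤ (m : ℝ) * (vmarg v (π i ⟨0, hm⟩) i - c i) :=
      mul_nonneg hm'.le (sub_nonneg.2 (h_cost i _))
    rcases le_total q (c i) with hqc | hqc
    · exact (mul_nonpos_of_nonneg_of_nonpos (Nat.cast_nonneg _) (sub_nonpos.2 hqc)).trans h_rhs
    by_cases h_ex : ∃ j, q ≤ vmarg v (π i j) i
    · obtain ⟨j, hj, hj_min⟩ := WellFounded.has_min (wellFounded_lt (α := Fin m))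
        {j | q ≤ vmarg v (π i j) i} h_ex
      have h_le : ((univ.filter fun j : Fin m => q ≤ vmarg v j i).card : ℝ) ≤
          m - (j.val : ℝ) := by
        rw [← h_card i j, Nat.cast_le]
        refine Finset.card_le_card fun k hk => Finset.mem_map.2 ⟨(π i).symm k, ?_, by simp⟩
        refine Finset.mem_Ici.2 (not_lt.1 (hj_min _ ?_))
        simpa using hk
      have h := h_sorted i j
      rw [div_mul_eq_mul_div, le_div_iff₀ (h_sub j), mul_comm] at h
      exact (mul_le_mul h_le (sub_le_sub_right hj _) (sub_nonneg.2 hqc) (h_sub j).le).trans h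
    · rw [Finset.filter_false_of_mem fun j _ hj => h_ex ⟨(π i).symm j, by simpa using hj⟩]
      simpa using h_rhs
end

section
/- Suppose exactly one buyer has a (general normalized monotone) submodular valuation and all other buyers have additive valuations, and suppose for every item i ∈ N and every j ∈ {2,…,m}: v_{π_i(j),i} − c_i < (m/(m−j+1)) · (v_{π_i(1),i} − c_i), and v_{π_i(1),i} > c_i for every i ∈ N. Then for every family of demand maps D_1,…,D_m as in the model there is exactly one pure Nash equilibrium, it is market clearing, and it is given by p_i = v_{π_i(1),i} for all i ∈ N. -/
open Finset

theorem IsDemandMap.mem_of_le_marginal {n : ℕ} {v : Finset (Fin n) → ℝ}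
    {D : (Fin n → ℝ) → Finset (Fin n)} (hD : IsDemandMap v D) (hv : IsValuation v)
    {p : Fin n → ℝ} {i : Fin n} (h : p i ≤ v univ - v (univ.erase i)) : i ∈ D p := by
  by_contra hi
  have hsub : D p ⊆ univ.erase i := fun x hx =>
    mem_erase.2 ⟨fun hxi => hi (hxi ▸ hx), mem_univ x⟩
  have hmarg := hv.2.2.2 _ _ i hsub (notMem_erase i univ)
  rw [insert_erase (mem_univ i)] at hmarg
  have hutil : util v p (D p) ≤ util v p (insert i (D p)) := by
    simp only [util, sum_insert hi]
    linarith
  have hcard := (hD p).2 _ (le_antisymm ((hD p).1 _) hutil)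
  rw [card_insert_of_notMem hi] at hcard
  omega

theorem IsDemandMap.le_sub_erase {n : ℕ} {v : Finset (Fin n) → ℝ}
    {D : (Fin n → ℝ) → Finset (Fin n)} (hD : IsDemandMap v D)
    {p : Fin n → ℝ} {i : Fin n} (hi : i ∈ D p) : p i ≤ v (D p) - v ((D p).erase i) := by
  have hutil := (hD p).1 ((D p).erase i)
  simp only [util] at hutil
  linarith [add_sum_erase (D p) p hi]

theorem IsAdditive.sub_erase {n : ℕ} {v : Finset (Fin n) → ℝ} (hv : IsAdditive v)
    {S : Finset (Fin n)} {i : Fin n} (hi : i ∈ S) : v S - v (S.erase i) = v {i} := by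
  rw [hv S, hv (S.erase i)]
  linarith [add_sum_erase S (fun k => v {k}) hi]

theorem IsDemandMap.le_marginal_of_isAdditive {n : ℕ} {v : Finset (Fin n) → ℝ}
    {D : (Fin n → ℝ) → Finset (Fin n)} (hD : IsDemandMap v D) (hv : IsAdditive v)
    {p : Fin n → ℝ} {i : Fin n} (hi : i ∈ D p) : p i ≤ v univ - v (univ.erase i) := by
  rw [hv.sub_erase (mem_univ i), ← hv.sub_erase hi]
  exact hD.le_sub_erase hi

/-- If the values `w` listed by `σ` do not grow too fast above the first one, then pricing
strictly above the first value is strictly worse than selling to everyone at that value. -/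
theorem card_filter_le_mul_lt {m : ℕ} (hm : 0 < m) (w : Fin m → ℝ) (c : ℝ)
    (σ : Equiv.Perm (Fin m))
    (hcond : ∀ j : Fin m, 1 ≤ j.val →
      w (σ j) - c < (m : ℝ) / ((m : ℝ) - (j.val : ℝ)) * (w (σ ⟨0, hm⟩) - c))
    (hc : c < w (σ ⟨0, hm⟩)) {q : ℝ} (hq : w (σ ⟨0, hm⟩) < q) :
    (#{j | q ≤ w j} : ℝ) * (q - c) < m * (w (σ ⟨0, hm⟩) - c) := by
  have hm' : (0 : ℝ) < m := by exact_mod_cast hm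
  set B : Finset (Fin m) := {k | q ≤ w (σ k)} with hB
  have hcard : #{j | q ≤ w j} = #B :=
    (card_bij (fun k _ => σ k) (by simp [hB]) (fun _ _ _ _ h => σ.injective h)
      fun j hj => ⟨σ.symm j, by simpa [hB] using hj, by simp⟩).symm
  rw [hcard]
  rcases B.eq_empty_or_nonempty with h | h
  · rw [h]
    simpa using mul_pos hm' (sub_pos.2 hc)
  set k := B.min' h
  have hqk : q ≤ w (σ k) := (mem_filter.1 (B.min'_mem h)).2
  have hk1 : 1 ≤ k.val := by
    by_contra! h0
    have : k = ⟨0, hm⟩ := Fin.ext (by simpa using h0)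
    rw [this] at hqk
    linarith
  have hle : #B ≤ m - k.val := by
    rw [← Fin.card_Ici]
    exact card_le_card fun x hx => mem_Ici.2 (B.min'_le x hx)
  have hle' : (#B : ℝ) ≤ m - k.val := by
    rw [← Nat.cast_sub k.isLt.le]
    exact_mod_cast hle
  have hpos : (0 : ℝ) < m - k.val := sub_pos.2 (by exact_mod_cast k.isLt)
  have hlt := hcond k hk1
  rw [div_mul_eq_mul_div, lt_div_iff₀ hpos] at hlt
  calc (#B : ℝ) * (q - c) ≤ (m - k.val) * (q - c) :=
        mul_le_mul_of_nonneg_right hle' (by linarith)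
    _ ≤ (m - k.val) * (w (σ k) - c) := mul_le_mul_of_nonneg_left (by linarith) hpos.le
    _ < m * (w (σ ⟨0, hm⟩) - c) := by linarith

/-- one submodular buyer, all other buyers additive, with the
strict sorted conditions (for all items `i` and 1-based indices `j+1 ≥ 2`):
`v_{π_i(j+1),i} - c_i < (m/(m-j)) (v_{π_i(1),i} - c_i)` and
`v_{π_i(1),i} > c_i`. Then there is exactly one pure Nash equilibrium, given by
`p_i = v_{π_i(1),i}`, and it is market clearing. -/
theorem unique_PNE_one_submodular_rest_additive {n m : ℕ} (hm : 0 < m)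
    (v : Fin m → Finset (Fin n) → ℝ) (c : Fin n → ℝ)
    (hv : ∀ j, IsValuation (v j)) (hc : ∀ i, 0 ≤ c i)
    (j₀ : Fin m) (hadd : ∀ j, j ≠ j₀ → IsAdditive (v j))
    (π : Fin n → Equiv.Perm (Fin m))
    (hπ : ∀ (i : Fin n) (j k : Fin m), j ≤ k → vmarg v (π i j) i ≤ vmarg v (π i k) i)
    (hcond : ∀ (i : Fin n) (j : Fin m), 1 ≤ j.val →
      vmarg v (π i j) i - c i <
        (m : ℝ) / ((m : ℝ) - (j.val : ℝ)) * (vmarg v (π i ⟨0, hm⟩) i - c i))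
    (hci : ∀ i : Fin n, c i < vmarg v (π i ⟨0, hm⟩) i)
    (D : Fin m → (Fin n → ℝ) → Finset (Fin n))
    (hD : ∀ j, IsDemandMap (v j) (D j)) :
    (∀ p, IsPNE D c p ↔ p = fun i => vmarg v (π i ⟨0, hm⟩) i) ∧
    MarketClearing D (fun i => vmarg v (π i ⟨0, hm⟩) i) := by
  set V : Fin n → ℝ := fun i => vmarg v (π i ⟨0, hm⟩) i with hV
  have hm' : (0 : ℝ) < m := by exact_mod_cast hm
  have hVle : ∀ j i, V i ≤ vmarg v j i := fun j i => by
    simpa using hπ i ⟨0, hm⟩ ((π i).symm j) (Nat.zero_le _)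
  have hmem : ∀ j p i, p i ≤ vmarg v j i → i ∈ D j p := fun j p i h =>
    (hD j).mem_of_le_marginal (hv j) h
  have hle_of_univ : ∀ j p i, D j p = univ → p i ≤ vmarg v j i := fun j p i h => by
    have := (hD j).le_sub_erase (p := p) (i := i) (by simp [h])
    rwa [h] at this
  have hsell : ∀ i q, V i < q →
      (#{j | q ≤ vmarg v j i} : ℝ) * (q - c i) < m * (V i - c i) := fun i q hq =>
    card_filter_le_mul_lt hm (fun j => vmarg v j i) (c i) (π i) (hcond i) (hci i) hq
  have hfull : ∀ p i, p i ≤ V i → profit D c p i = m * (p i - c i) := fun p i h => by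
    have : #{j | i ∈ D j p} = m := by
      rw [filter_true_of_mem fun j _ => hmem j p i (h.trans (hVle j i))]
      simp
    rw [profit, this]
  have hhigh : ∀ p i, V i < p i → (∀ j, i ∈ D j p → p i ≤ vmarg v j i) →
      profit D c p i < m * (V i - c i) := fun p i h hj => by
    refine lt_of_le_of_lt ?_ (hsell i (p i) h)
    refine mul_le_mul_of_nonneg_right ?_ (by linarith [hci i])
    exact_mod_cast card_le_card (monotone_filter_right _ fun j _ => hj j)
  refine ⟨fun p => ⟨fun hp => ?_, ?_⟩, fun j => eq_univ_of_forall fun i => hmem j V i (hVle j i)⟩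
  · have hge : ∀ i, m * (V i - c i) ≤ profit D c p i := fun i => by
      have := hp.2 i (V i) ((hc i).trans (hci i).le)
      rwa [hfull _ i (by simp), Function.update_self] at this
    have hVp : ∀ i, V i ≤ p i := fun i => by
      by_contra! h
      have := hge i
      rw [hfull p i h.le] at this
      have := le_of_mul_le_mul_left this hm'
      linarith
    have huniv : D j₀ p = univ := eq_univ_of_forall fun i => by
      by_contra hi
      have hlt : V i < p i := by
        by_contra! h
        exact hi (hmem j₀ p i (h.trans (hVle j₀ i)))
      refine (hhigh p i hlt fun j hj => ?_).not_ge (hge i)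
      have hne : j ≠ j₀ := fun h => hi (h ▸ hj)
      exact (hD j).le_marginal_of_isAdditive (hadd j hne) hj
    funext i
    refine le_antisymm ?_ (hVp i)
    by_contra! hlt
    refine (hhigh p i hlt fun j hj => ?_).not_ge (hge i)
    rcases eq_or_ne j j₀ with rfl | hne
    · exact hle_of_univ j p i huniv
    · exact (hD j).le_marginal_of_isAdditive (hadd j hne) hj
  · rintro rfl
    refine ⟨fun i => (hc i).trans (hci i).le, fun i q _ => ?_⟩
    rw [hfull V i le_rfl]
    rcases le_or_gt q (V i) with hq | hq
    · rw [hfull _ i (by simpa using hq), Function.update_self]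
      exact mul_le_mul_of_nonneg_left (by linarith) hm'.le
    · refine (hhigh _ i (by simpa using hq) fun j hj => hle_of_univ j _ i ?_).le
      refine eq_univ_of_forall fun k => ?_
      rcases eq_or_ne k i with rfl | hki
      · exact hj
      · exact hmem j _ k (by simpa [hki] using hVle j k)
end

section
/- Consider the instance with n = 2 sellers, m = 2 buyers, two copies per seller, zero production costs, buyer 1 submodular with v_1({1}) = 200, v_1({2}) = 210, v_1({1,2}) = 220, and buyer 2 additive with v_2({1}) = 70, v_2({2}) = 50. Then for every ε with 0 ≤ ε < 5 and every family of demand maps D_1, D_2 as in the model, no price vector is an ε-Nash equilibrium; in particular no pure Nash equilibrium exists. -/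
open Finset

/-- A demanded bundle among two items, with the inequalities witnessing that it is optimal and
that a tie with a larger bundle does not occur. -/
theorem IsDemandMap.two_items {v : Finset (Fin 2) → ℝ} {D : (Fin 2 → ℝ) → Finset (Fin 2)}
    (hD : IsDemandMap v D) (h0 : v ∅ = 0) (p : Fin 2 → ℝ) :
    (D p = ∅ ∧ v {0} < p 0 ∧ v {1} < p 1) ∨
    (D p = {0} ∧ p 0 ≤ v {0} ∧ v {1} - p 1 ≤ v {0} - p 0 ∧ v {0, 1} - v {0} < p 1) ∨
    (D p = {1} ∧ p 1 ≤ v {1} ∧ v {0} - p 0 ≤ v {1} - p 1 ∧ v {0, 1} - v {1} < p 0) ∨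
    (D p = {0, 1} ∧ p 1 ≤ v {0, 1} - v {0} ∧ p 0 ≤ v {0, 1} - v {1}) := by
  obtain ⟨hmax, hcard⟩ := hD p
  have e := hmax ∅
  have e0 := hmax {0}
  have e1 := hmax {1}
  have e01 := hmax {0, 1}
  have c0 := hcard {0}
  have c1 := hcard {1}
  have c01 := hcard {0, 1}
  have hcases : ∀ S : Finset (Fin 2), S = ∅ ∨ S = {0} ∨ S = {1} ∨ S = {0, 1} := by decide
  rcases hcases (D p) with h | h | h | h <;> rw [h] at e e0 e1 e01 c0 c1 c01 <;>
    simp [util, h0] at e e0 e1 e01 c0 c1 c01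
  · exact Or.inl ⟨h, lt_of_le_of_ne (by linarith) (fun t => c0 (by linarith)),
      lt_of_le_of_ne (by linarith) (fun t => c1 (by linarith))⟩
  · exact Or.inr <| Or.inl ⟨h, by linarith, by linarith,
      lt_of_le_of_ne (by linarith) (fun t => c01 (by linarith))⟩
  · exact Or.inr <| Or.inr <| Or.inl ⟨h, by linarith, by linarith,
      lt_of_le_of_ne (by linarith) (fun t => c01 (by linarith))⟩
  · exact Or.inr <| Or.inr <| Or.inr ⟨h, by linarith, by linarith⟩

/-- With two buyers and zero costs, the profit is the price times the sum of the two purchase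
indicators. -/
theorem profit_two_buyers {n : ℕ} (D : Fin 2 → (Fin n → ℝ) → Finset (Fin n)) (p : Fin n → ℝ)
    (i : Fin n) :
    profit D (fun _ => 0) p i =
      ((if i ∈ D 0 p then 1 else 0) + (if i ∈ D 1 p then 1 else 0)) * p i := by
  rw [profit, Finset.card_filter, Fin.sum_univ_two]
  push_cast
  rw [sub_zero]

/-- Example `noequi`: two sellers (two copies each, zero costs)
and two buyers with `v_1` taking values 200, 210, 220 and `v_2` additive with
values 70, 50. For every `0 ≤ ε < 5` and every demand maps, no price vector is
an `ε`-Nash equilibrium; in particular no pure Nash equilibrium exists. -/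
theorem no_epsNE_example {v : Fin 2 → Finset (Fin 2) → ℝ}
    (hv10 : v 0 ∅ = 0) (hv11 : v 0 {0} = 200) (hv12 : v 0 {1} = 210)
    (hv13 : v 0 {0, 1} = 220)
    (hv20 : v 1 ∅ = 0) (hv21 : v 1 {0} = 70) (hv22 : v 1 {1} = 50)
    (hv23 : v 1 {0, 1} = 120)
    (D : Fin 2 → (Fin 2 → ℝ) → Finset (Fin 2))
    (hD : ∀ j, IsDemandMap (v j) (D j))
    (ε : ℝ) (hε0 : 0 ≤ ε) (hε : ε < 5) :
    ∀ p : Fin 2 → ℝ, ¬ IsEpsNE D (fun _ => 0) ε p := by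
  rintro p ⟨-, hNE⟩
  have second : ∀ p i, i ∈ D 1 p ↔ p i ≤ v 1 {i} := by
    intro p i
    rcases (hD 1).two_items hv20 p with ⟨h, _⟩ | ⟨h, _⟩ | ⟨h, _⟩ | ⟨h, _⟩ <;>
      fin_cases i <;> simp [h] <;> linarith
  have first0 : ∀ p, p 0 ≤ 200 → p 0 < p 1 - 10 → 0 ∈ D 0 p := by
    intro p _ _
    rcases (hD 0).two_items hv10 p with ⟨h, _⟩ | ⟨h, _⟩ | ⟨h, _⟩ | ⟨h, _⟩ <;>
      simp [h] <;> linarith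
  have first1 : ∀ p, p 1 ≤ 210 → p 1 < p 0 + 10 → 1 ∈ D 0 p := by
    intro p _ _
    rcases (hD 0).two_items hv10 p with ⟨h, _⟩ | ⟨h, _⟩ | ⟨h, _⟩ | ⟨h, _⟩ <;>
      simp [h] <;> linarith
  have single : ∀ i q, 0 ≤ q → q ≤ v 1 {i} → q ≤ profit D (fun _ => 0) p i + ε := by
    intro i q hq hqv
    refine le_trans ?_ (hNE i q hq)
    have : i ∈ D 1 (Function.update p i q) := (second _ _).2 (by simpa using hqv)
    rw [profit_two_buyers, if_pos this]
    split_ifs <;> simp only [Function.update_self] <;> linarith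
  have both : ∀ i q, 0 ≤ q → q ≤ v 1 {i} → i ∈ D 0 (Function.update p i q) →
      2 * q ≤ profit D (fun _ => 0) p i + ε := by
    intro i q hq hqv h
    refine le_trans ?_ (hNE i q hq)
    have : i ∈ D 1 (Function.update p i q) := (second _ _).2 (by simpa using hqv)
    rw [profit_two_buyers, if_pos this, if_pos h]
    simp only [Function.update_self]
    linarith
  have both0 : ∀ q, 0 ≤ q → q ≤ 70 → q < p 1 - 10 →
      2 * q ≤ profit D (fun _ => 0) p 0 + ε := fun q hq hq' hlt =>
    both 0 q hq (by linarith) (first0 _ (by simp; linarith) (by simpa using hlt))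
  have both1 : ∀ q, 0 ≤ q → q ≤ 50 → q < p 0 + 10 →
      2 * q ≤ profit D (fun _ => 0) p 1 + ε := fun q hq hq' hlt =>
    both 1 q hq (by linarith) (first1 _ (by simp; linarith) (by simpa using hlt))
  have s0 := single 0 70 (by norm_num) hv21.ge
  have s1 := single 1 50 (by norm_num) hv22.ge
  simp only [profit_two_buyers, second, hv21, hv22] at s0 s1 both0 both1
  rcases (hD 0).two_items hv10 p with
      ⟨h, h1, h2⟩ | ⟨h, h1, h2, h3⟩ | ⟨h, h1, h2, h3⟩ | ⟨h, h1, h2⟩ <;>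
    simp only [h, hv11, hv12, hv13] at * <;> simp at s0 s1 both0 both1
  · split_ifs at s0 <;> linarith
  · split_ifs at s0 s1 both1 <;>
      first | linarith | linarith [both1 42 (by norm_num) (by norm_num) (by linarith)]
  · split_ifs at s0
    · have b1 := both1 50 (by norm_num) le_rfl (by linarith)
      split_ifs at b1 both0
      · linarith [both0 (p 1 - 10 - (5 - ε) / 2) (by linarith) (by linarith) (by linarith)]
      · linarith
    · linarith
  · split_ifs at s0 <;> linarith
end

section
/- Suppose all production costs are zero, buyer 1 has a normalized monotone submodular valuation whose demand map is up-consistent (for any price vector p, any item i, and any p'_i ≥ p_i, writing p' = (p'_i, p_{−i}), either buyer 1 demands the same set at p' as at p, or buyer 1 does not demand item i at p'), and buyers 2,…,m have additive valuations. Then for every ε > 0 there exists a market clearing ε-Nash equilibrium. -/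
open Finset

/-- A sequential demand map: given prices and a set `A` of still-available items,
it selects a subset of `A` maximizing utility, of maximum cardinality among
such maximizers. -/
def IsSeqDemandMap {n : ℕ} (v : Finset (Fin n) → ℝ)
    (D : (Fin n → ℝ) → Finset (Fin n) → Finset (Fin n)) : Prop :=
  ∀ p A, D p A ⊆ A ∧ (∀ S ⊆ A, util v p S ≤ util v p (D p A)) ∧
    ∀ S ⊆ A, util v p S = util v p (D p A) → S.card ≤ (D p A).card

/-- `avail D p j` is the set of items still unsold after buyers `1, …, j` (i.e.
the first `j` buyers, 0-indexed `0, …, j-1`) have purchased in order. -/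
def avail {n m : ℕ} (D : Fin m → (Fin n → ℝ) → Finset (Fin n) → Finset (Fin n))
    (p : Fin n → ℝ) : ℕ → Finset (Fin n)
  | 0 => Finset.univ
  | j + 1 => if h : j < m then avail D p j \ D ⟨j, h⟩ p (avail D p j) else avail D p j

/-- Profit of seller `i`: `p i - c i` if item `i` is sold to some buyer, else `0`. -/
def sprofit {n m : ℕ} (D : Fin m → (Fin n → ℝ) → Finset (Fin n) → Finset (Fin n))
    (c : Fin n → ℝ) (p : Fin n → ℝ) (i : Fin n) : ℝ :=
  if i ∈ avail D p m then 0 else p i - c i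

/-- `ε`-Nash equilibrium of the sequential pricing game (taking `ε = 0` gives a
pure Nash equilibrium). -/
def SeqEpsNE {n m : ℕ} (D : Fin m → (Fin n → ℝ) → Finset (Fin n) → Finset (Fin n))
    (c : Fin n → ℝ) (ε : ℝ) (p : Fin n → ℝ) : Prop :=
  (∀ i, 0 ≤ p i) ∧
    ∀ (i : Fin n) (q : ℝ), 0 ≤ q →
      sprofit D c (Function.update p i q) i ≤ sprofit D c p i + ε

theorem util_insert {n : ℕ} (v : Finset (Fin n) → ℝ) (p : Fin n → ℝ) {S : Finset (Fin n)}
    {i : Fin n} (hi : i ∉ S) :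
    util v p (insert i S) = util v p S + (v (insert i S) - v S - p i) := by
  simp only [util, Finset.sum_insert hi]
  ring

theorem IsAdditive.apply_insert {n : ℕ} {v : Finset (Fin n) → ℝ} (hv : IsAdditive v)
    {S : Finset (Fin n)} {i : Fin n} (hi : i ∉ S) : v (insert i S) = v {i} + v S := by
  rw [hv (insert i S), hv S, Finset.sum_insert hi]

/-- A price charged to a demanding buyer is at most the item's marginal value. -/
theorem IsSeqDemandMap.price_le {n : ℕ} {v : Finset (Fin n) → ℝ}
    {D : (Fin n → ℝ) → Finset (Fin n) → Finset (Fin n)} (hD : IsSeqDemandMap v D)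
    {p : Fin n → ℝ} {A : Finset (Fin n)} {i : Fin n} (hi : i ∈ D p A) :
    p i ≤ v (D p A) - v ((D p A).erase i) := by
  obtain ⟨hsub, hmax, -⟩ := hD p A
  have h := hmax ((D p A).erase i) ((Finset.erase_subset _ _).trans hsub)
  have h' := util_insert v p (Finset.notMem_erase i (D p A))
  rw [Finset.insert_erase hi] at h'
  linarith

/-- A buyer with an additive valuation demands exactly the available items that are worth
their price. -/
theorem IsSeqDemandMap.mem_iff_of_isAdditive {n : ℕ} {v : Finset (Fin n) → ℝ}
    {D : (Fin n → ℝ) → Finset (Fin n) → Finset (Fin n)} (hD : IsSeqDemandMap v D)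
    (hv : IsAdditive v) {p : Fin n → ℝ} {A : Finset (Fin n)} {i : Fin n} :
    i ∈ D p A ↔ i ∈ A ∧ p i ≤ v {i} := by
  obtain ⟨hsub, hmax, hcard⟩ := hD p A
  refine ⟨fun hi => ⟨hsub hi, ?_⟩, fun ⟨hiA, hle⟩ => ?_⟩
  · have h := hD.price_le hi
    have h' := hv.apply_insert (Finset.notMem_erase i (D p A))
    rw [Finset.insert_erase hi] at h'
    linarith
  · by_contra hi
    have hins : insert i (D p A) ⊆ A := Finset.insert_subset hiA hsub
    have hu := util_insert v p hi
    rw [hv.apply_insert hi] at hu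
    have hc := hcard _ hins (le_antisymm (hmax _ hins) (by linarith))
    rw [Finset.card_insert_of_notMem hi] at hc
    omega

/-- At zero prices a buyer with a monotone valuation demands every available item. -/
theorem IsSeqDemandMap.eq_of_prices_zero {n : ℕ} {v : Finset (Fin n) → ℝ}
    {D : (Fin n → ℝ) → Finset (Fin n) → Finset (Fin n)} (hD : IsSeqDemandMap v D)
    (hv : IsValuation v) {p : Fin n → ℝ} (hp : ∀ i, p i = 0) (A : Finset (Fin n)) :
    D p A = A := by
  obtain ⟨hsub, hmax, hcard⟩ := hD p A
  have hu : ∀ S, util v p S = v S := fun S => by simp [util, hp]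
  refine Finset.eq_of_subset_of_card_le hsub (hcard A subset_rfl ?_)
  refine le_antisymm (hmax A subset_rfl) ?_
  rw [hu, hu]
  exact hv.2.2.1 _ _ hsub

theorem mem_avail_iff {n m : ℕ} (D : Fin m → (Fin n → ℝ) → Finset (Fin n) → Finset (Fin n))
    (p : Fin n → ℝ) (i : Fin n) (k : ℕ) :
    i ∈ avail D p k ↔ ∀ j : Fin m, (j : ℕ) < k → i ∉ D j p (avail D p j) := by
  induction k with
  | zero => simp [avail]
  | succ k ih =>
    by_cases h : k < m
    · rw [avail, dif_pos h, Finset.mem_sdiff, ih]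
      constructor
      · rintro ⟨h₁, h₂⟩ j hj
        rcases Nat.lt_succ_iff_lt_or_eq.mp hj with hj | hj
        · exact h₁ j hj
        · subst hj
          exact h₂
      · exact fun H => ⟨fun j hj => H j (by omega), H ⟨k, h⟩ (Nat.lt_succ_self k)⟩
    · rw [avail, dif_neg h, ih]
      exact forall_congr' fun j => ⟨fun H _ => H (by omega), fun H hj => H (by omega)⟩

/-- If all buyers but the first are additive, an item stays unsold exactly if the first buyer
does not demand it and its price exceeds its value for each of the other buyers. -/
theorem mem_avail_iff_of_isAdditive {n m : ℕ} (hm : 0 < m) {v : Fin m → Finset (Fin n) → ℝ}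
    (hadd : ∀ j : Fin m, j ≠ ⟨0, hm⟩ → IsAdditive (v j))
    {D : Fin m → (Fin n → ℝ) → Finset (Fin n) → Finset (Fin n)}
    (hD : ∀ j, IsSeqDemandMap (v j) (D j)) (p : Fin n → ℝ) (i : Fin n) :
    i ∈ avail D p m ↔
      i ∉ D ⟨0, hm⟩ p Finset.univ ∧ ∀ j : Fin m, j ≠ ⟨0, hm⟩ → v j {i} < p i := by
  constructor
  · intro h
    have H := (mem_avail_iff D p i m).mp h
    refine ⟨H ⟨0, hm⟩ hm, fun j hj => ?_⟩
    by_contra! hle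
    exact H j j.2 (((hD j).mem_iff_of_isAdditive (hadd j hj)).mpr
      ⟨(mem_avail_iff D p i j).mpr fun l _ => H l l.2, hle⟩)
  · rintro ⟨h₀, h⟩
    refine (mem_avail_iff D p i m).mpr fun j _ hmem => ?_
    by_cases hj : j = ⟨0, hm⟩
    · subst hj
      exact h₀ hmem
    · exact absurd (((hD j).mem_iff_of_isAdditive (hadd j hj)).mp hmem).2 (not_le.mpr (h j hj))

/-- The highest value of an item for the buyers other than the first (zero if there are none). -/
theorem exists_max_value {n m : ℕ} (j₀ : Fin m) {v : Fin m → Finset (Fin n) → ℝ}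
    (hv : ∀ j, IsValuation (v j)) :
    ∃ w : Fin n → ℝ, (∀ i, 0 ≤ w i) ∧ (∀ i, ∀ j ≠ j₀, v j {i} ≤ w i) ∧
      ((∀ i, w i = 0) ∨ ∀ i, ∃ j ≠ j₀, v j {i} = w i) := by
  by_cases h : ∃ j, j ≠ j₀
  · obtain ⟨j₁, hj₁⟩ := h
    have hmax : ∀ i : Fin n, ∃ j ≠ j₀, ∀ l ≠ j₀, v l {i} ≤ v j {i} := fun i => by
      obtain ⟨j, hj, hle⟩ := Finset.exists_max_image (Finset.univ.erase j₀) (fun j => v j {i})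
        ⟨j₁, by simp [hj₁]⟩
      exact ⟨j, by simpa using hj, fun l hl => hle l (by simp [hl])⟩
    choose f hf hle using hmax
    exact ⟨fun i => v (f i) {i}, fun i => (hv _).2.1 _, fun i j hj => hle i j hj,
      Or.inr fun i => ⟨f i, hf i, rfl⟩⟩
  · push Not at h
    exact ⟨0, fun _ => le_rfl, fun i j hj => absurd (h j) hj, Or.inl fun _ => rfl⟩

/-- single-copy sequential game with zero costs, buyer 1
submodular with an up-consistent demand map, buyers `2, …, m` additive. Then
for every `ε > 0` there exists a market clearing `ε`-Nash equilibrium. -/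
theorem seq_exists_marketClearing_epsNE {n m : ℕ} (hm : 0 < m)
    (v : Fin m → Finset (Fin n) → ℝ)
    (hv : ∀ j, IsValuation (v j))
    (hadd : ∀ j : Fin m, j ≠ ⟨0, hm⟩ → IsAdditive (v j))
    (D : Fin m → (Fin n → ℝ) → Finset (Fin n) → Finset (Fin n))
    (hD : ∀ j, IsSeqDemandMap (v j) (D j))
    (hup : ∀ (p : Fin n → ℝ) (i : Fin n) (q : ℝ), p i ≤ q →
      D ⟨0, hm⟩ (Function.update p i q) Finset.univ = D ⟨0, hm⟩ p Finset.univ ∨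
        i ∉ D ⟨0, hm⟩ (Function.update p i q) Finset.univ)
    (ε : ℝ) (hε : 0 < ε) :
    ∃ p : Fin n → ℝ, SeqEpsNE D (fun _ => 0) ε p ∧ avail D p m = ∅ := by
  classical
  obtain ⟨w, hw0, hwle, hw⟩ := exists_max_value ⟨0, hm⟩ hv
  set d : (Fin n → ℝ) → Finset (Fin n) := fun p => D ⟨0, hm⟩ p Finset.univ
  have hunsold := mem_avail_iff_of_isAdditive hm hadd hD
  -- Among price vectors above `w` that keep buyer 1's demand at `w`, nearly maximize the sum.
  let P : Set (Fin n → ℝ) := {p | (∀ i, w i ≤ p i) ∧ d p = d w ∧ ∀ i, i ∉ d w → p i = w i}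
  have hbdd : BddAbove ((fun p : Fin n → ℝ => ∑ i, p i) '' P) := by
    refine ⟨∑ i, max (w i) (v ⟨0, hm⟩ (d w)), ?_⟩
    rintro _ ⟨p, ⟨-, hpd, hpw⟩, rfl⟩
    refine Finset.sum_le_sum fun i _ => ?_
    by_cases hi : i ∈ d w
    · have h := (hD ⟨0, hm⟩).price_le (p := p) (A := Finset.univ) (i := i)
        (show i ∈ d p from hpd ▸ hi)
      change p i ≤ v ⟨0, hm⟩ (d p) - _ at h
      rw [hpd] at h
      have h0 := (hv ⟨0, hm⟩).2.1 ((d p).erase i)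
      exact le_max_of_le_right (by linarith)
    · exact le_max_of_le_left (hpw i hi).le
  have hne : ((fun p : Fin n → ℝ => ∑ i, p i) '' P).Nonempty :=
    ⟨_, w, ⟨fun _ => le_rfl, rfl, fun _ _ => rfl⟩, rfl⟩
  obtain ⟨_, ⟨p, ⟨hpw, hpd, hpoff⟩, rfl⟩, hlt⟩ := exists_lt_of_lt_csSup hne
    (sub_lt_self (sSup ((fun p : Fin n → ℝ => ∑ i, p i) '' P)) hε)
  have hclear : avail D p m = ∅ := by
    refine Finset.eq_empty_of_forall_notMem fun i hi => ?_
    obtain ⟨hi0, hij⟩ := (hunsold p i).mp hi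
    have hiw : i ∉ d w := hpd ▸ hi0
    rcases hw with hw | hw
    · have : d w = Finset.univ := (hD ⟨0, hm⟩).eq_of_prices_zero (hv _) hw _
      exact hiw (this ▸ Finset.mem_univ i)
    · obtain ⟨j, hj, hji⟩ := hw i
      exact (hij j hj).ne (hji.trans (hpoff i hiw).symm)
  refine ⟨p, ⟨fun i => (hw0 i).trans (hpw i), fun i q _ => ?_⟩, hclear⟩
  have hp0 := (hw0 i).trans (hpw i)
  have hprofit : sprofit D (fun _ => 0) p i = p i := by simp [sprofit, hclear]
  rw [hprofit]
  by_cases hsold : i ∈ avail D (Function.update p i q) m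
  · simp only [sprofit, if_pos hsold]
    linarith
  simp only [sprofit, if_neg hsold, Function.update_self, sub_zero]
  by_contra! hq
  have hwq : w i < q := by linarith [hpw i]
  have hmem : i ∈ d (Function.update p i q) := by
    by_contra hnot
    refine hsold ((hunsold _ i).mpr ⟨hnot, fun j hj => ?_⟩)
    rw [Function.update_self]
    exact (hwle i j hj).trans_lt hwq
  have hsame : d (Function.update p i q) = d p :=
    (hup p i q (by linarith)).resolve_right (not_not_intro hmem)
  have hiw : i ∈ d w := hpd ▸ hsame ▸ hmem
  have hP : Function.update p i q ∈ P := by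
    refine ⟨fun l => ?_, hsame.trans hpd, fun l hl => ?_⟩
    · rcases eq_or_ne l i with rfl | hli
      · rw [Function.update_self]
        exact hwq.le
      · rw [Function.update_of_ne hli]
        exact hpw l
    · rw [Function.update_of_ne (ne_of_mem_of_not_mem hiw hl).symm]
      exact hpoff l hl
  have hle := le_csSup hbdd (Set.mem_image_of_mem (fun p : Fin n → ℝ => ∑ i, p i) hP)
  have hsum : ∑ l, Function.update p i q l = q + ∑ l ∈ Finset.univ \ {i}, p l :=
    Finset.sum_update_of_mem (Finset.mem_univ i) p q
  have hsum' : ∑ l, p l = p i + ∑ l ∈ Finset.univ \ {i}, p l := by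
    simp
  simp only at hle hlt
  linarith
end

section
/- Let k be the largest index i with v_{1,i} − v_{2,i} > 0 (and k = 0 if there is none). For a price vector p with ∑_{i∈N} p_i < B, p is a market clearing pure Nash equilibrium if and only if all of the following hold: (i) v_{2,i} ≤ 2·v_{1,i} for every i ∈ N; (ii) p_i = min{v_{1,i}, v_{2,i}} for every i ∈ N; (iii) for every item i and every set A ⊆ {1,…,k} ∖ {i} such that p_i = v_{2,i}, v_{1,i} > 2·v_{2,i}, and 2·v_{2,i} + ∑_{j ∈ {1,…,k} ∖ (A ∪ {i})} v_{2,j} < B, one has ∑_{j∈A} (v_{1,j} − v_{2,j}) ≥ v_{1,i} − 2·v_{2,i}. -/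
open Finset

/-- The set purchased by the (budgetless) additive buyer 2: all items priced at
most their value. -/
noncomputable def buyer2set {n : ℕ} (v2 : Fin n → ℝ) (p : Fin n → ℝ) : Finset (Fin n) :=
  Finset.univ.filter fun i => p i ≤ v2 i

/-- `D1` is a demand map for the budgeted additive buyer 1 with values `v1` and
budget `B`: at every price vector it selects a budget-feasible bundle maximizing
additive utility, of maximum cardinality among such maximizers. -/
def IsBudgetDemand {n : ℕ} (v1 : Fin n → ℝ) (B : ℝ)
    (D1 : (Fin n → ℝ) → Finset (Fin n)) : Prop :=
  ∀ p, (∑ i ∈ D1 p, p i ≤ B) ∧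
    (∀ S : Finset (Fin n), ∑ i ∈ S, p i ≤ B →
      ∑ i ∈ S, (v1 i - p i) ≤ ∑ i ∈ D1 p, (v1 i - p i)) ∧
    ∀ S : Finset (Fin n), ∑ i ∈ S, p i ≤ B →
      ∑ i ∈ S, (v1 i - p i) = ∑ i ∈ D1 p, (v1 i - p i) → S.card ≤ (D1 p).card

/-- Profit of seller `i` (two copies, zero production cost): number of buyers
purchasing item `i` times its price. -/
noncomputable def bprofit {n : ℕ} (v2 : Fin n → ℝ) (D1 : (Fin n → ℝ) → Finset (Fin n))
    (p : Fin n → ℝ) (i : Fin n) : ℝ :=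
  (((if i ∈ D1 p then 1 else 0) + (if i ∈ buyer2set v2 p then 1 else 0) : ℝ)) * p i

/-- Pure Nash equilibrium of the budgeted two-copy pricing game. -/
def BPNE {n : ℕ} (v2 : Fin n → ℝ) (D1 : (Fin n → ℝ) → Finset (Fin n))
    (p : Fin n → ℝ) : Prop :=
  (∀ i, 0 ≤ p i) ∧
    ∀ (i : Fin n) (q : ℝ), 0 ≤ q →
      bprofit v2 D1 (Function.update p i q) i ≤ bprofit v2 D1 p i

/-- Market clearing: both buyers purchase every item. -/
def BMarketClearing {n : ℕ} (v2 : Fin n → ℝ) (D1 : (Fin n → ℝ) → Finset (Fin n))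
    (p : Fin n → ℝ) : Prop :=
  D1 p = Finset.univ ∧ buyer2set v2 p = Finset.univ

theorem IsBudgetDemand.eq_univ {n : ℕ} {v1 : Fin n → ℝ} {B : ℝ}
    {D1 : (Fin n → ℝ) → Finset (Fin n)} (hD1 : IsBudgetDemand v1 B D1) {p : Fin n → ℝ}
    (hp : ∀ i, p i ≤ v1 i) (hB : ∑ i, p i ≤ B) : D1 p = Finset.univ := by
  obtain ⟨-, hmax, hcard⟩ := hD1 p
  have hle : ∑ i ∈ D1 p, (v1 i - p i) ≤ ∑ i, (v1 i - p i) :=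
    Finset.sum_le_sum_of_subset_of_nonneg (Finset.subset_univ _)
      fun i _ _ => sub_nonneg.2 (hp i)
  exact Finset.eq_univ_of_card _ (le_antisymm (Finset.card_le_univ _)
    (hcard _ hB (le_antisymm (hmax _ hB) hle)))

theorem IsBudgetDemand.price_le {n : ℕ} {v1 : Fin n → ℝ} {B : ℝ}
    {D1 : (Fin n → ℝ) → Finset (Fin n)} (hD1 : IsBudgetDemand v1 B D1) {p : Fin n → ℝ}
    {i : Fin n} (hp : 0 ≤ p i) (hi : i ∈ D1 p) : p i ≤ v1 i := by
  obtain ⟨hB, hmax, -⟩ := hD1 p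
  have h1 := Finset.add_sum_erase (D1 p) p hi
  have h2 := Finset.add_sum_erase (D1 p) (fun j => v1 j - p j) hi
  have h3 := hmax ((D1 p).erase i) (by linarith)
  linarith

theorem sum_comp_update_of_notMem {ι α β : Type*} [DecidableEq ι] [AddCommMonoid β]
    (f : ι → α → β) (p : ι → α) {i : ι} (q : α) {T : Finset ι} (hi : i ∉ T) :
    ∑ j ∈ T, f j (Function.update p i q j) = ∑ j ∈ T, f j (p j) :=
  Finset.sum_congr rfl fun j hj => by
    rw [Function.update_of_ne (ne_of_mem_of_not_mem hj hi)]

theorem sum_comp_update_of_mem {ι α β : Type*} [DecidableEq ι] [AddCommMonoid β]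
    (f : ι → α → β) (p : ι → α) {i : ι} (q : α) {T : Finset ι} (hi : i ∈ T) :
    ∑ j ∈ T, f j (Function.update p i q j) = f i q + ∑ j ∈ T.erase i, f j (p j) := by
  rw [← Finset.add_sum_erase _ _ hi, sum_comp_update_of_notMem f p q (T.notMem_erase i),
    Function.update_self]

/-- If the budget is slack, every price in a market clearing equilibrium equals the smaller
of the two buyers' values. -/
theorem BPNE.price_eq_min {n : ℕ} {v1 v2 : Fin n → ℝ} {B : ℝ}
    {D1 : (Fin n → ℝ) → Finset (Fin n)} (hD1 : IsBudgetDemand v1 B D1) {p : Fin n → ℝ}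
    (hpB : ∑ i, p i < B) (hN : BPNE v2 D1 p) (hM : BMarketClearing v2 D1 p) (i : Fin n) :
    p i = min (v1 i) (v2 i) := by
  obtain ⟨hp0, hN⟩ := hN
  obtain ⟨hM1, hM2⟩ := hM
  have hp1 : ∀ j, p j ≤ v1 j := fun j => hD1.price_le (hp0 j) (by simp [hM1])
  have hp2 : ∀ j, p j ≤ v2 j := fun j => by
    have : j ∈ buyer2set v2 p := by simp [hM2]
    simpa [buyer2set] using this
  refine le_antisymm (le_min (hp1 i) (hp2 i)) (le_of_not_gt fun hlt => ?_)
  obtain ⟨q, hq, hqlt⟩ := exists_between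
    (lt_min hlt (show p i < p i + (B - ∑ j, p j) by linarith))
  obtain ⟨hqm, hqB⟩ := lt_min_iff.1 hqlt
  obtain ⟨hq1, hq2⟩ := lt_min_iff.1 hqm
  have hD : D1 (Function.update p i q) = Finset.univ := by
    refine hD1.eq_univ (fun j => ?_) ?_
    · rcases eq_or_ne j i with rfl | hj
      · simpa using hq1.le
      · simpa [hj] using hp1 j
    · have h1 := sum_comp_update_of_mem (fun _ x => x) p q (Finset.mem_univ i)
      have h2 := Finset.add_sum_erase Finset.univ p (Finset.mem_univ i)
      linarith
  have := hN i q ((hp0 i).trans hq.le)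
  simp only [bprofit, hD, hM1, hM2] at this
  simp [buyer2set, hq2.le] at this
  linarith

theorem sum_erase_eq_add_of_support {ι : Type*} [Fintype ι] [DecidableEq ι] {g : ι → ℝ}
    {K A : Finset ι} {i : ι} (hg : ∀ j, j ∉ K → g j = 0) (hA : A ⊆ K.erase i) :
    ∑ j ∈ Finset.univ.erase i, g j = ∑ j ∈ A, g j + ∑ j ∈ K \ insert i A, g j := by
  have h1 : ∑ j ∈ K.erase i, g j = ∑ j ∈ Finset.univ.erase i, g j :=
    Finset.sum_subset (Finset.erase_subset_erase _ (Finset.subset_univ _))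
      fun j hj hjK => hg j fun h =>
        hjK (Finset.mem_erase.2 ⟨Finset.ne_of_mem_erase hj, h⟩)
  have h2 : K.erase i \ A = K \ insert i A := by ext; simp; tauto
  rw [← h1, ← Finset.sum_sdiff hA, h2, add_comm]

/-- non-budget-consuming characterization, Lemmas in the
appendix: items are sorted by non-increasing `v_{1,i} - v_{2,i}` and `k` is
the number of items with `v_{1,i} - v_{2,i} > 0` (so the items with positive
gap are exactly those of (0-based) index `< k`, and `k = 0` if there are
none). For a price vector `p` with `∑_i p_i < B`, `p` is a market clearing
pure Nash equilibrium iff: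
(i) `v_{2,i} ≤ 2 v_{1,i}` for every `i`;
(ii) `p_i = min (v_{1,i}) (v_{2,i})` for every `i`; and
(iii) for every item `i` and every `A ⊆ [k] \ {i}` with `p_i = v_{2,i}`,
`v_{1,i} > 2 v_{2,i}` and `2 v_{2,i} + ∑_{j ∈ [k] \ (A ∪ {i})} v_{2,j} < B`,
one has `∑_{j ∈ A} (v_{1,j} - v_{2,j}) ≥ v_{1,i} - 2 v_{2,i}`. -/
theorem budget_marketClearing_characterization_nonconsuming {n : ℕ}
    (v1 v2 : Fin n → ℝ) (hv1 : ∀ i, 0 ≤ v1 i) (hv2 : ∀ i, 0 ≤ v2 i)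
    (B : ℝ) (hB : 0 < B)
    (hsort : ∀ i j : Fin n, i ≤ j → v1 j - v2 j ≤ v1 i - v2 i)
    (D1 : (Fin n → ℝ) → Finset (Fin n)) (hD1 : IsBudgetDemand v1 B D1)
    (k : ℕ) (hkn : k ≤ n)
    (hk : ∀ i : Fin n, v2 i < v1 i ↔ i.val < k)
    (p : Fin n → ℝ) (hpB : ∑ i : Fin n, p i < B) :
    (BPNE v2 D1 p ∧ BMarketClearing v2 D1 p) ↔
      ((∀ i, v2 i ≤ 2 * v1 i) ∧
        (∀ i, p i = min (v1 i) (v2 i)) ∧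
        ∀ (i : Fin n) (A : Finset (Fin n)),
          A ⊆ (Finset.univ.filter fun j : Fin n => j.val < k).erase i →
          p i = v2 i → 2 * v2 i < v1 i →
          2 * v2 i +
              ∑ j ∈ (Finset.univ.filter fun j : Fin n => j.val < k) \ insert i A, v2 j
            < B →
          v1 i - 2 * v2 i ≤ ∑ j ∈ A, (v1 j - v2 j)) := by
  set K : Finset (Fin n) := Finset.univ.filter fun j : Fin n => j.val < k with hK
  have hKmem : ∀ j, j ∈ K ↔ v2 j < v1 j := fun j => by simp [hK, hk]
  have hcommon : (∀ i, p i = min (v1 i) (v2 i)) →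
      (∀ j, p j ≤ v1 j) ∧ (∀ j, p j ≤ v2 j) ∧ (∀ j ∈ K, p j = v2 j) ∧
        (∀ j, j ∉ K → v1 j - p j = 0) := by
    intro hmin
    refine ⟨fun j => hmin j ▸ min_le_left _ _, fun j => hmin j ▸ min_le_right _ _,
      fun j hj => ?_, fun j hj => ?_⟩
    · rw [hmin, min_eq_right ((hKmem j).1 hj).le]
    · rw [hmin, min_eq_left (not_lt.1 (mt (hKmem j).2 hj)), sub_self]
  constructor
  · rintro ⟨hN, hM⟩
    have hmin := hN.price_eq_min hD1 hpB hM
    obtain ⟨hp1, hp2, hpK, hg⟩ := hcommon hmin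
    obtain ⟨hp0, hN⟩ := hN
    obtain ⟨hM1, hM2⟩ := hM
    have hprofit : ∀ i, bprofit v2 D1 p i = 2 * p i := fun i => by
      simp only [bprofit, hM1, hM2, Finset.mem_univ, if_true]
      ring
    refine ⟨fun i => ?_, hmin, fun i A hA hpi hi hfeas => ?_⟩
    · have h := hN i (v2 i) (hv2 i)
      rw [hprofit] at h
      have h' : v2 i ≤ bprofit v2 D1 (Function.update p i (v2 i)) i := by
        have := hv2 i
        simp only [bprofit, buyer2set, Finset.mem_filter, Finset.mem_univ, true_and,
          Function.update_self, le_refl, if_true]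
        split_ifs <;> linarith
      linarith [hp1 i]
    · by_contra! hlt
      obtain ⟨q, hq, hqlt⟩ := exists_between (lt_min
        (show 2 * v2 i < B - ∑ j ∈ K \ insert i A, v2 j by linarith)
        (show 2 * v2 i < v1 i - ∑ j ∈ A, (v1 j - v2 j) by linarith))
      obtain ⟨hqB, hqv⟩ := lt_min_iff.1 hqlt
      have hv2i := hv2 i
      have hiD : i ∈ D1 (Function.update p i q) := by
        by_contra hiD
        have hni : i ∉ K \ insert i A := by simp
        have hT1 := sum_comp_update_of_mem (fun _ x => x) p q
          (Finset.mem_insert_self i (K \ insert i A))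
        have hT2 := sum_comp_update_of_mem (fun j x => v1 j - x) p q
          (Finset.mem_insert_self i (K \ insert i A))
        rw [Finset.erase_insert hni] at hT1 hT2
        have hc : ∑ j ∈ K \ insert i A, p j = ∑ j ∈ K \ insert i A, v2 j :=
          Finset.sum_congr rfl fun j hj => hpK j (Finset.mem_sdiff.1 hj).1
        have hAc : ∑ j ∈ A, (v1 j - p j) = ∑ j ∈ A, (v1 j - v2 j) :=
          Finset.sum_congr rfl fun j hj => by
            rw [hpK j (Finset.mem_of_mem_erase (hA hj))]
        have hopt := (hD1 (Function.update p i q)).2.1 (insert i (K \ insert i A))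
          (by linarith)
        have hS := sum_comp_update_of_notMem (fun j x => v1 j - x) p q hiD
        have hle : ∑ j ∈ D1 (Function.update p i q), (v1 j - p j) ≤
            ∑ j ∈ Finset.univ.erase i, (v1 j - p j) :=
          Finset.sum_le_sum_of_subset_of_nonneg
            (fun j hj => Finset.mem_erase.2
              ⟨ne_of_mem_of_not_mem hj hiD, Finset.mem_univ j⟩)
            fun j _ _ => sub_nonneg.2 (hp1 j)
        have hdec := sum_erase_eq_add_of_support hg hA
        linarith
      have h := hN i q (by linarith)
      have hq2 : ¬ q ≤ v2 i := by linarith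
      rw [hprofit] at h
      simp [bprofit, buyer2set, hiD, hq2] at h
      linarith
  · rintro ⟨h2, hmin, hex⟩
    obtain ⟨hp1, hp2, hpK, hg⟩ := hcommon hmin
    have hp0 : ∀ i, 0 ≤ p i := fun i => hmin i ▸ le_min (hv1 i) (hv2 i)
    have hM1 : D1 p = Finset.univ := hD1.eq_univ hp1 hpB.le
    have hM2 : buyer2set v2 p = Finset.univ := by
      ext j; simp [buyer2set, hp2 j]
    refine ⟨⟨hp0, fun i q hq => ?_⟩, hM1, hM2⟩
    have hprofit : bprofit v2 D1 p i = 2 * p i := by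
      simp only [bprofit, hM1, hM2, Finset.mem_univ, if_true]
      ring
    have hD1le : i ∈ D1 (Function.update p i q) → q ≤ v1 i := fun h => by
      simpa using hD1.price_le (by simpa using hq) h
    have hpi := hp0 i
    rw [hprofit]
    simp only [bprofit, buyer2set, Finset.mem_filter, Finset.mem_univ, true_and,
      Function.update_self]
    split_ifs with hi hq2 hq2
    · have : q ≤ p i := hmin i ▸ le_min (hD1le hi) hq2
      linarith
    · have hqv := hD1le hi
      have hiK : i ∈ K := (hKmem i).2 (by linarith)
      have hpi2 := hpK i hiK
      by_contra! hgt
      set S := D1 (Function.update p i q) with hS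
      have hA : K \ S ⊆ K.erase i := fun j hj => by
        obtain ⟨hjK, hjS⟩ := Finset.mem_sdiff.1 hj
        exact Finset.mem_erase.2 ⟨(ne_of_mem_of_not_mem hi hjS).symm, hjK⟩
      have hsub : K \ insert i (K \ S) ⊆ S.erase i := fun j hj => by
        simp only [Finset.mem_sdiff, Finset.mem_insert, Finset.mem_erase] at hj ⊢
        tauto
      obtain ⟨hfeas, hopt, -⟩ := hD1 (Function.update p i q)
      rw [← hS] at hfeas hopt
      have hS1 := sum_comp_update_of_mem (fun _ x => x) p q hi
      have hS2 := sum_comp_update_of_mem (fun j x => v1 j - x) p q hi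
      have hc : ∑ j ∈ K \ insert i (K \ S), p j = ∑ j ∈ K \ insert i (K \ S), v2 j :=
        Finset.sum_congr rfl fun j hj => hpK j (Finset.mem_sdiff.1 hj).1
      have hAc : ∑ j ∈ K \ S, (v1 j - p j) = ∑ j ∈ K \ S, (v1 j - v2 j) :=
        Finset.sum_congr rfl fun j hj => by rw [hpK j (Finset.mem_sdiff.1 hj).1]
      have hpsub : ∑ j ∈ K \ insert i (K \ S), p j ≤ ∑ j ∈ S.erase i, p j :=
        Finset.sum_le_sum_of_subset_of_nonneg hsub fun j _ _ => hp0 j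
      have hgain := hex i (K \ S) hA hpi2 (by linarith) (by linarith)
      have hgsub : ∑ j ∈ K \ insert i (K \ S), (v1 j - p j) =
          ∑ j ∈ S.erase i, (v1 j - p j) :=
        Finset.sum_subset hsub fun j hj hjn => hg j fun hjK => hjn (by
          simp only [Finset.mem_sdiff, Finset.mem_insert, Finset.mem_erase] at hj ⊢
          tauto)
      have hdec := sum_erase_eq_add_of_support hg hA
      have hU1 := sum_comp_update_of_notMem (fun _ x => x) p q
        (Finset.notMem_erase i Finset.univ)
      have hU2 := sum_comp_update_of_notMem (fun j x => v1 j - x) p q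
        (Finset.notMem_erase i Finset.univ)
      have hU3 := Finset.add_sum_erase Finset.univ p (Finset.mem_univ i)
      have hbest := hopt (Finset.univ.erase i) (by linarith)
      linarith
    · have : q ≤ 2 * p i := by
        rcases min_choice (v1 i) (v2 i) with h | h <;> rw [hmin i, h]
        · exact hq2.trans (h2 i)
        · linarith [hv2 i]
      linarith
    · linarith
end
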